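/- arXiv:2207.03089 — 2 statements merged into one kernel-verified Lean document; each statement's English description precedes it below -/
import Mathlib

section
/- Let q, X, t be complex numbers with q ≠ 0, X ≠ 0, X² ∉ {1, q⁴, q^{−4}}, q^{−19}X^{−1}t³ ≠ 1, q^{−6}t² ≠ 1, q^{−1}X^{−1}t ≠ 1, q^{−1}Xt ≠ 1, and q^{−5}X^{−1}t ≠ 1. Then −q⁸X²/[(1−X²)(1−q⁴X²)(1−q⁸X²)] · (1 + q^{−9}X^{−1}t + q^{−18}X^{−2}t²)/[(1−q^{−19}X^{−1}t³)(1−q^{−5}X^{−1}t)(1−q^{−1}X^{−1}t)] − q⁴X²/[(1−X²)²(1−q⁴X²)] · (1 + (q^{−5}+q^{−9})tX^{−1} + (q^{−10}+q^{−14})t² + q^{−19}t³X^{−1})/[(1−q^{−19}X^{−1}t³)(1−q^{−6}t²)(1−q^{−1}X^{−1}t)] − X²/[(1−X²)²(1−q^{−4}X²)] · (1 + (q^{−5}+q^{−9})tX + (q^{−10}+q^{−14})t² + q^{−19}t³X)/[(1−q^{−19}X^{−1}t³)(1−q^{−6}t²)(1−q^{−1}Xt)] = −X²(1 + q⁴ +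 q⁸)/[(1−X²)(1−q^{−4}X²)(1−q⁸X²)·(1−q^{−5}X^{−1}t)(1−q^{−1}X^{−1}t)(1−q^{−1}Xt)], provided additionally q⁸X² ≠ 1. -/
/-- The identity in terms of `p = q ^ 4` and `u = q ^ (-5) * t`, over an arbitrary field. -/
theorem rational_identity_of_ne {K : Type*} [Field K] {p X u : K} (hp : p ≠ 0) (hX : X ≠ 0)
    (h1 : 1 - X ^ 2 ≠ 0) (h2 : p - X ^ 2 ≠ 0) (h3 : 1 - p * X ^ 2 ≠ 0)
    (h4 : p * X - u ^ 3 ≠ 0) (h5 : 1 - p * u ^ 2 ≠ 0) (h6 : X - p * u ≠ 0)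
    (h7 : 1 - p * X * u ≠ 0) (h8 : X - u ≠ 0) (h9 : 1 - p ^ 2 * X ^ 2 ≠ 0) :
    -p ^ 2 * X ^ 2 / ((1 - X ^ 2) * (1 - p * X ^ 2) * (1 - p ^ 2 * X ^ 2)) *
        ((1 + u / (p * X) + u ^ 2 / (p * X) ^ 2) /
          ((1 - u ^ 3 / (p * X)) * (1 - u / X) * (1 - p * u / X))) -
      p * X ^ 2 / ((1 - X ^ 2) ^ 2 * (1 - p * X ^ 2)) *
        ((1 + (1 + 1 / p) * u * X⁻¹ + (1 + 1 / p) * u ^ 2 + u ^ 3 / p * X⁻¹) /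
          ((1 - u ^ 3 / (p * X)) * (1 - p * u ^ 2) * (1 - p * u / X))) -
      X ^ 2 / ((1 - X ^ 2) ^ 2 * (1 - X ^ 2 / p)) *
        ((1 + (1 + 1 / p) * u * X + (1 + 1 / p) * u ^ 2 + u ^ 3 / p * X) /
          ((1 - u ^ 3 / (p * X)) * (1 - p * u ^ 2) * (1 - p * X * u))) =
    -X ^ 2 * (1 + p + p ^ 2) /
      ((1 - X ^ 2) * (1 - X ^ 2 / p) * (1 - p ^ 2 * X ^ 2) *
        ((1 - u / X) * (1 - p * u / X) * (1 - p * X * u))) := by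
  have hpX : 1 - X ^ 2 / p = (p - X ^ 2) / p := by field_simp
  have hpXu : 1 - u ^ 3 / (p * X) = (p * X - u ^ 3) / (p * X) := by field_simp
  have hXpu : 1 - p * u / X = (X - p * u) / X := by field_simp
  have hXu : 1 - u / X = (X - u) / X := by field_simp
  rw [hpX, hpXu, hXpu, hXu]
  field_simp
  ring

/-- The rational function identity (6.2) in the computation of `H_p(X,t)`. -/
theorem A2P2_A3P3_A4P4_identity (q X t : ℂ) (hq : q ≠ 0) (hX : X ≠ 0)
    (h1 : X ^ 2 ≠ 1) (h2 : X ^ 2 ≠ q ^ 4) (h3 : X ^ 2 ≠ q ^ (-4 : ℤ))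
    (h4 : q ^ (-19 : ℤ) * X⁻¹ * t ^ 3 ≠ 1) (h5 : q ^ (-6 : ℤ) * t ^ 2 ≠ 1)
    (h6 : q⁻¹ * X⁻¹ * t ≠ 1) (h7 : q⁻¹ * X * t ≠ 1) (h8 : q ^ (-5 : ℤ) * X⁻¹ * t ≠ 1)
    (h9 : q ^ 8 * X ^ 2 ≠ 1) :
    -q ^ 8 * X ^ 2 / ((1 - X ^ 2) * (1 - q ^ 4 * X ^ 2) * (1 - q ^ 8 * X ^ 2)) *
        ((1 + q ^ (-9 : ℤ) * X⁻¹ * t + q ^ (-18 : ℤ) * X ^ (-2 : ℤ) * t ^ 2) /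
          ((1 - q ^ (-19 : ℤ) * X⁻¹ * t ^ 3) * (1 - q ^ (-5 : ℤ) * X⁻¹ * t) *
            (1 - q⁻¹ * X⁻¹ * t))) -
      q ^ 4 * X ^ 2 / ((1 - X ^ 2) ^ 2 * (1 - q ^ 4 * X ^ 2)) *
        ((1 + (q ^ (-5 : ℤ) + q ^ (-9 : ℤ)) * t * X⁻¹ +
            (q ^ (-10 : ℤ) + q ^ (-14 : ℤ)) * t ^ 2 + q ^ (-19 : ℤ) * t ^ 3 * X⁻¹) /
          ((1 - q ^ (-19 : ℤ) * X⁻¹ * t ^ 3) * (1 - q ^ (-6 : ℤ) * t ^ 2) *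
            (1 - q⁻¹ * X⁻¹ * t))) -
      X ^ 2 / ((1 - X ^ 2) ^ 2 * (1 - q ^ (-4 : ℤ) * X ^ 2)) *
        ((1 + (q ^ (-5 : ℤ) + q ^ (-9 : ℤ)) * t * X +
            (q ^ (-10 : ℤ) + q ^ (-14 : ℤ)) * t ^ 2 + q ^ (-19 : ℤ) * t ^ 3 * X) /
          ((1 - q ^ (-19 : ℤ) * X⁻¹ * t ^ 3) * (1 - q ^ (-6 : ℤ) * t ^ 2) *
            (1 - q⁻¹ * X * t))) =
    -X ^ 2 * (1 + q ^ 4 + q ^ 8) /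
      ((1 - X ^ 2) * (1 - q ^ (-4 : ℤ) * X ^ 2) * (1 - q ^ 8 * X ^ 2) *
        ((1 - q ^ (-5 : ℤ) * X⁻¹ * t) * (1 - q⁻¹ * X⁻¹ * t) * (1 - q⁻¹ * X * t))) := by
  obtain ⟨u, rfl⟩ : ∃ u, t = q ^ 5 * u := ⟨t / q ^ 5, by field_simp⟩
  have hq8 : q ^ 8 = (q ^ 4) ^ 2 := by ring
  have hfrac : q ^ (-9 : ℤ) * X⁻¹ * (q ^ 5 * u) = u / (q ^ 4 * X) := by field_simp
  have hfrac_sq : q ^ (-18 : ℤ) * X ^ (-2 : ℤ) * (q ^ 5 * u) ^ 2 = u ^ 2 / (q ^ 4 * X) ^ 2 := by field_simp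
  have hcube_div : q ^ (-19 : ℤ) * X⁻¹ * (q ^ 5 * u) ^ 3 = u ^ 3 / (q ^ 4 * X) := by field_simp
  have hinv5 : q ^ (-5 : ℤ) * X⁻¹ * (q ^ 5 * u) = u / X := by field_simp
  have hinv1 : q⁻¹ * X⁻¹ * (q ^ 5 * u) = q ^ 4 * u / X := by field_simp
  have hlin : (q ^ (-5 : ℤ) + q ^ (-9 : ℤ)) * (q ^ 5 * u) = (1 + 1 / q ^ 4) * u := by field_simp
  have hsq : (q ^ (-10 : ℤ) + q ^ (-14 : ℤ)) * (q ^ 5 * u) ^ 2 = (1 + 1 / q ^ 4) * u ^ 2 := by field_simp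
  have hcube : q ^ (-19 : ℤ) * (q ^ 5 * u) ^ 3 = u ^ 3 / q ^ 4 := by field_simp
  have hsq6 : q ^ (-6 : ℤ) * (q ^ 5 * u) ^ 2 = q ^ 4 * u ^ 2 := by field_simp
  have hqXt : q⁻¹ * X * (q ^ 5 * u) = q ^ 4 * X * u := by field_simp
  have hXsq : q ^ (-4 : ℤ) * X ^ 2 = X ^ 2 / q ^ 4 := by field_simp
  rw [hq8, hfrac, hfrac_sq, hcube_div, hinv5, hinv1,
    hlin, hsq, hcube, hsq6, hqXt, hXsq]
  rw [hcube_div] at h4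
  rw [hsq6] at h5
  rw [hinv1] at h6
  rw [hqXt] at h7
  rw [hinv5] at h8
  rw [hq8] at h9
  exact rational_identity_of_ne (p := q ^ 4) (u := u) (pow_ne_zero 4 hq) hX
    (sub_ne_zero.2 h1.symm) (sub_ne_zero.2 h2.symm)
    (fun h => h3 (by field_simp; linear_combination -h))
    (fun h => h4 (by field_simp; linear_combination -h)) (sub_ne_zero.2 h5.symm)
    (fun h => h6 (by field_simp; linear_combination -h)) (sub_ne_zero.2 h7.symm)
    (fun h => h8 (by field_simp; linear_combination -h)) (sub_ne_zero.2 h9.symm)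
end

section
/- Let q, X, t be complex numbers with q ≠ 0, X ≠ 0, and X² ∉ {1, q⁴, q^{−4}, q⁸, q^{−8}}. Then (1 − q^{−9}Xt)(1 − q^{−5}Xt)(1 − q^{−1}Xt)/[(1 − X²)(1 − q⁴X²)(1 − q⁸X²)] − X²(1 + q⁴ + q⁸)(1 − q^{−9}Xt)(1 − q^{−9}X^{−1}t)(1 − q^{−5}Xt)/[(1 − X²)(1 − q^{−4}X²)(1 − q⁸X²)] + (1 − q^{−9}X^{−1}t)(1 − q^{−5}X^{−1}t)(1 − q^{−1}X^{−1}t)/[(1 − X^{−2})(1 − q⁴X^{−2})(1 − q⁸X^{−2})] − X^{−2}(1 + q⁴ + q⁸)(1 − q^{−9}Xt)(1 − q^{−9}X^{−1}t)(1 − q^{−5}X^{−1}t)/[(1 − X^{−2})(1 − q^{−4}X^{−2})(1 − q⁸X^{−2})] = 1. -/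
/-- The identity behind `Kp_eq_one`, written in terms of `p = q ^ 4` and `s = q ^ (-9) * t`. -/
theorem Kp_aux {F : Type*} [Field F] (p X s : F) (hp : p ≠ 0) (hX : X ≠ 0)
    (h1 : 1 - X ^ 2 ≠ 0) (h2 : X ^ 2 - p ≠ 0) (h3 : 1 - p * X ^ 2 ≠ 0)
    (h4 : X ^ 2 - p ^ 2 ≠ 0) (h5 : 1 - p ^ 2 * X ^ 2 ≠ 0) :
    (1 - s * X) * (1 - p * s * X) * (1 - p ^ 2 * s * X) /
        ((1 - X ^ 2) * (1 - p * X ^ 2) * (1 - p ^ 2 * X ^ 2)) -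
      X ^ 2 * (1 + p + p ^ 2) * (1 - s * X) * (1 - s * X⁻¹) * (1 - p * s * X) /
        ((1 - X ^ 2) * (1 - p⁻¹ * X ^ 2) * (1 - p ^ 2 * X ^ 2)) +
      (1 - s * X⁻¹) * (1 - p * s * X⁻¹) * (1 - p ^ 2 * s * X⁻¹) /
        ((1 - (X ^ 2)⁻¹) * (1 - p * (X ^ 2)⁻¹) * (1 - p ^ 2 * (X ^ 2)⁻¹)) -
      (X ^ 2)⁻¹ * (1 + p + p ^ 2) * (1 - s * X) * (1 - s * X⁻¹) * (1 - p * s * X⁻¹) /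
        ((1 - (X ^ 2)⁻¹) * (1 - p⁻¹ * (X ^ 2)⁻¹) * (1 - p ^ 2 * (X ^ 2)⁻¹)) = 1 := by
  have e1 : 1 - p⁻¹ * X ^ 2 = -(X ^ 2 - p) / p := by field_simp; ring
  have e2 : 1 - (X ^ 2)⁻¹ = -(1 - X ^ 2) / X ^ 2 := by field_simp; ring
  have e3 : 1 - p * (X ^ 2)⁻¹ = (X ^ 2 - p) / X ^ 2 := by field_simp
  have e4 : 1 - p ^ 2 * (X ^ 2)⁻¹ = (X ^ 2 - p ^ 2) / X ^ 2 := by field_simp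
  have e5 : 1 - p⁻¹ * (X ^ 2)⁻¹ = -(1 - p * X ^ 2) / (p * X ^ 2) := by field_simp; ring
  rw [e1, e2, e3, e4, e5]
  rw [mul_comm] at h3 h5
  field_simp
  ring

/-- The identity `K_p(X,t) = 1` in the computation of `H_p(X,t)`. -/
theorem Kp_eq_one (q X t : ℂ) (hq : q ≠ 0) (hX : X ≠ 0)
    (h1 : X ^ 2 ≠ 1) (h2 : X ^ 2 ≠ q ^ 4) (h3 : X ^ 2 ≠ q ^ (-4 : ℤ))
    (h4 : X ^ 2 ≠ q ^ 8) (h5 : X ^ 2 ≠ q ^ (-8 : ℤ)) :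
    (1 - q ^ (-9 : ℤ) * X * t) * (1 - q ^ (-5 : ℤ) * X * t) * (1 - q⁻¹ * X * t) /
        ((1 - X ^ 2) * (1 - q ^ 4 * X ^ 2) * (1 - q ^ 8 * X ^ 2)) -
      X ^ 2 * (1 + q ^ 4 + q ^ 8) * (1 - q ^ (-9 : ℤ) * X * t) *
          (1 - q ^ (-9 : ℤ) * X⁻¹ * t) * (1 - q ^ (-5 : ℤ) * X * t) /
        ((1 - X ^ 2) * (1 - q ^ (-4 : ℤ) * X ^ 2) * (1 - q ^ 8 * X ^ 2)) +
      (1 - q ^ (-9 : ℤ) * X⁻¹ * t) * (1 - q ^ (-5 : ℤ) * X⁻¹ * t) * (1 - q⁻¹ * X⁻¹ * t) /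
        ((1 - X ^ (-2 : ℤ)) * (1 - q ^ 4 * X ^ (-2 : ℤ)) * (1 - q ^ 8 * X ^ (-2 : ℤ))) -
      X ^ (-2 : ℤ) * (1 + q ^ 4 + q ^ 8) * (1 - q ^ (-9 : ℤ) * X * t) *
          (1 - q ^ (-9 : ℤ) * X⁻¹ * t) * (1 - q ^ (-5 : ℤ) * X⁻¹ * t) /
        ((1 - X ^ (-2 : ℤ)) * (1 - q ^ (-4 : ℤ) * X ^ (-2 : ℤ)) *
          (1 - q ^ 8 * X ^ (-2 : ℤ))) = 1 := by
  have hp : q ^ 4 ≠ 0 := pow_ne_zero 4 hq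
  have n3 : 1 - q ^ 4 * X ^ 2 ≠ 0 := fun h => h3 <| by
    rw [zpow_neg]
    exact eq_inv_of_mul_eq_one_right (sub_eq_zero.mp h).symm
  have n5 : 1 - (q ^ 4) ^ 2 * X ^ 2 ≠ 0 := fun h => h5 <| by
    rw [← pow_mul] at h
    rw [zpow_neg]
    exact eq_inv_of_mul_eq_one_right (sub_eq_zero.mp h).symm
  have n4 : X ^ 2 - (q ^ 4) ^ 2 ≠ 0 := by
    rw [← pow_mul]
    exact sub_ne_zero.mpr h4
  have key := Kp_aux (q ^ 4) X (q ^ (-9 : ℤ) * t) hp hX (sub_ne_zero.mpr h1.symm)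
    (sub_ne_zero.mpr h2) n3 n4 n5
  have z5 : q ^ (-5 : ℤ) = q ^ 4 * q ^ (-9 : ℤ) := by
    rw [← zpow_natCast, ← zpow_add₀ hq]
    norm_num
  have z1 : q⁻¹ = q ^ 8 * q ^ (-9 : ℤ) := by
    rw [← zpow_natCast, ← zpow_add₀ hq]
    norm_num
  have z4 : q ^ (-4 : ℤ) = (q ^ 4)⁻¹ := zpow_neg q 4
  have zX : X ^ (-2 : ℤ) = (X ^ 2)⁻¹ := zpow_neg X 2
  rw [z5, z1, z4, zX]
  convert key using 1
  ring
end
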